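/- Lemma 3.5, part 2 (bound on Term2). There exist universal constants c, C > 0 such that the following holds. Let δ > 0, σ⁺ > 0, μ ≥ 1 and r ≤ q. Let U and U* be n×r real matrices with orthonormal columns, let b̃_k ∈ ℝ^r and b̂_k ∈ ℝ^r for k ∈ [q], and let B̂ be the r×q matrix with columns b̂_k. Assume (all deterministic): max_k ‖U*ᵀUb̂_k − b̃_k‖ ≤ 2.5·δ·μσ⁺√(r/q); max_k ‖b̂_k‖ ≤ 1.1·μσ⁺√(r/q); and ‖B̂‖ ≤ 1.1·σ⁺. Let a_ki (k ∈ [q], i ∈ [m]) be i.i.d. standard Gaussian random vectors in ℝⁿ. Then for every ε₂ ∈ (0,1), with probability at least 1 − exp(C·nr − c·mq·ε₂²/(r·μ²)), ‖(I − U*U*ᵀ)·Σ_{k,i} a_ki·(a_kiᵀU*(U*ᵀUb̂_k − b̃_k))·b̂_kᵀ‖_F ≤ 1.1·ε₂·δ·m·σ⁺². -/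

import Mathlib

open MeasureTheory ProbabilityTheory Matrix
open scoped ENNReal

noncomputable section

/-- Euclidean norm of a finitely-indexed real vector. -/
def vnorm {ι : Type*} [Fintype ι] (v : ι → ℝ) : ℝ := Real.sqrt (∑ i, v i ^ 2)

/-- Frobenius norm of a real matrix. -/
def frob {ι ι' : Type*} [Fintype ι] [Fintype ι'] (M : Matrix ι ι' ℝ) : ℝ :=
  Real.sqrt (∑ i, ∑ j, M i j ^ 2)

/-- Spectral (ℓ2 operator) norm of a real matrix. -/
def spec {ι ι' : Type*} [Fintype ι] [Fintype ι'] (M : Matrix ι ι' ℝ) : ℝ :=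
  sSup {c | ∃ z, vnorm z = 1 ∧ c = vnorm (M.mulVec z)}

/-- Smallest singular value of an r×q matrix with r ≤ q (or of a square matrix):
the minimum of ‖Bᵀw‖ over unit vectors w. -/
def sigMin {ι ι' : Type*} [Fintype ι] [Fintype ι'] (B : Matrix ι ι' ℝ) : ℝ :=
  sInf {c | ∃ w, vnorm w = 1 ∧ c = vnorm (Bᵀ.mulVec w)}

/-- The k-th column of a matrix. -/
def matCol {ι ι' : Type*} (B : Matrix ι ι' ℝ) (k : ι') : ι → ℝ := fun i => B i k

/-- Subspace distance SD(U₁,U₂) := ‖(I − U₁U₁ᵀ)U₂‖_F. -/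
def SD {n r : ℕ} (U₁ U₂ : Matrix (Fin n) (Fin r) ℝ) : ℝ :=
  frob ((1 - U₁ * U₁ᵀ) * U₂)

/-- The standard Gaussian measure on ℝ. -/
def stdGaussian : Measure ℝ := gaussianReal 0 1

instance : IsProbabilityMeasure stdGaussian :=
  inferInstanceAs (IsProbabilityMeasure (gaussianReal 0 1))

/-- A standard Gaussian random vector in ℝⁿ (i.i.d. N(0,1) coordinates). -/
def gaussianVec (n : ℕ) : Measure (Fin n → ℝ) := Measure.pi fun _ => stdGaussian

instance (n : ℕ) : IsProbabilityMeasure (gaussianVec n) := by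
  unfold gaussianVec; infer_instance

/-- i.i.d. standard Gaussian random vectors a_{k i} ∈ ℝⁿ, k ∈ [q], i ∈ [m]. -/
def gaussianMatrices (q m n : ℕ) : Measure (Fin q → Fin m → Fin n → ℝ) :=
  Measure.pi fun _ => Measure.pi fun _ => gaussianVec n

instance (q m n : ℕ) : IsProbabilityMeasure (gaussianMatrices q m n) := by
  unfold gaussianMatrices; infer_instance

/-- Truncated spectral-initialization matrix X̂₀ = (1/m) Σ_{k,i} a_ki y_ki 1{y_ki² ≤ α} e_kᵀ. -/
def initMat {n q m : ℕ} (xstar : Fin q → Fin n → ℝ) (α : ℝ)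
    (ω : Fin q → Fin m → Fin n → ℝ) : Matrix (Fin n) (Fin q) ℝ :=
  Matrix.of fun j k => (1 / (m : ℝ)) * ∑ i, ω k i j * (ω k i ⬝ᵥ xstar k) *
    (if (ω k i ⬝ᵥ xstar k) ^ 2 ≤ α then 1 else 0)

/-- Data-dependent truncation threshold α := C̃ Σ_{k,i} y_ki² / (mq). -/
def initAlpha {n q m : ℕ} (xstar : Fin q → Fin n → ℝ) (Ctil : ℝ)
    (ω : Fin q → Fin m → Fin n → ℝ) : ℝ :=
  Ctil * ((∑ k, ∑ i, (ω k i ⬝ᵥ xstar k) ^ 2) / ((m : ℝ) * q))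

/-- β(α) := E[ζ² 1{‖x‖² ζ² ≤ α}] for ζ standard Gaussian. -/
def betaK (normx α : ℝ) : ℝ :=
  ∫ z, z ^ 2 * (if normx ^ 2 * z ^ 2 ≤ α then 1 else 0) ∂stdGaussian

/-- The least-squares estimate b̂ := (UᵀAᵀAU)⁻¹ Uᵀ Aᵀ A x. -/
def lsEst {n r m : ℕ} (U : Matrix (Fin n) (Fin r) ℝ) (A : Matrix (Fin m) (Fin n) ℝ)
    (x : Fin n → ℝ) : Fin r → ℝ :=
  ((Uᵀ * Aᵀ * A * U)⁻¹ * Uᵀ * Aᵀ * A).mulVec x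

/-- Gradient w.r.t. U of the squared loss: Σ_k Aᵀ(AUb̂_k − Ax*_k)b̂_kᵀ. -/
def gradU {n r q m : ℕ} (U : Matrix (Fin n) (Fin r) ℝ)
    (A : Fin q → Matrix (Fin m) (Fin n) ℝ) (xstar : Fin q → Fin n → ℝ)
    (bhat : Fin q → Fin r → ℝ) : Matrix (Fin n) (Fin r) ℝ :=
  ∑ k, (A k)ᵀ * vecMulVec ((A k).mulVec (U.mulVec (bhat k) - xstar k)) (bhat k)

/-- `U` has orthonormal columns whose span is the span of eigenvectors of `S`
corresponding to its `r` largest eigenvalues: `S` maps the column span of `U` into itself,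
and wᵀSw ≥ zᵀSz for unit w in the span and unit z orthogonal to it. -/
def IsTopREigenBasis {n r : ℕ} (S : Matrix (Fin n) (Fin n) ℝ)
    (U : Matrix (Fin n) (Fin r) ℝ) : Prop :=
  Uᵀ * U = 1 ∧ (∃ M : Matrix (Fin r) (Fin r) ℝ, S * U = U * M) ∧
  ∀ w z : Fin n → ℝ, (∃ cvec : Fin r → ℝ, w = U.mulVec cvec) → Uᵀ.mulVec z = 0 →
    vnorm w = 1 → vnorm z = 1 → z ⬝ᵥ S.mulVec z ≤ w ⬝ᵥ S.mulVec w

/-- Sample sizes for the 2T+1 sample splits: batch τ ∈ {0,…,T} has m τ rows,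
batch τ = T + t (t ∈ {1,…,T}) has m t rows. -/
def msize (m : ℕ → ℕ) (T τ : ℕ) : ℕ := if τ ≤ T then m τ else m (τ - T)

/-- The joint distribution of all 2T+1 independent sample batches of i.i.d. standard
Gaussian measurement vectors. -/
def splitGauss (m : ℕ → ℕ) (T q n : ℕ) :
    Measure (∀ τ : Fin (2 * T + 1), Fin q → Fin (msize m T τ.1) → Fin n → ℝ) :=
  Measure.pi fun τ => gaussianMatrices q (msize m T τ.1) n

instance (m : ℕ → ℕ) (T q n : ℕ) : IsProbabilityMeasure (splitGauss m T q n) := by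
  unfold splitGauss; infer_instance

end

lemma lintegral_pi_prod_eq_prod_lintegral {ι : Type*} [Fintype ι] {Ω : ι → Type*}
    [∀ i, MeasurableSpace (Ω i)] (μ : ∀ i, Measure (Ω i)) [∀ i, IsProbabilityMeasure (μ i)]
    {f : ∀ i, Ω i → ℝ≥0∞} (hf : ∀ i, Measurable (f i)) :
    ∫⁻ x, ∏ i, f i (x i) ∂Measure.pi μ = ∏ i, ∫⁻ y, f i y ∂μ i := by
  refine (lintegral_prod_eq_prod_lintegral_of_indepFun Finset.univ
    (fun i (x : ∀ i, Ω i) => f i (x i))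
    (iIndepFun_pi fun i => (hf i).aemeasurable)
    fun i => (hf i).comp (measurable_pi_apply i)).trans ?_
  exact Finset.prod_congr rfl fun i _ =>
    (measurePreserving_eval μ i).lintegral_comp (hf i)

lemma lintegral_exp_mul_sq_gaussianReal_le {s : ℝ} (hs0 : 0 ≤ s) (hs : s ≤ 1 / 4) :
    ∫⁻ y, ENNReal.ofReal (Real.exp (s * y ^ 2 / 2)) ∂gaussianReal 0 1
      ≤ ENNReal.ofReal (Real.exp s) := by
  have hb : 0 < (1 - s) / 2 := by linarith
  rw [gaussianReal_of_var_ne_zero 0 one_ne_zero,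
    lintegral_withDensity_eq_lintegral_mul _ (measurable_gaussianPDF 0 1) (by fun_prop)]
  have hpt : ∀ y : ℝ, (gaussianPDF 0 1 * fun y => ENNReal.ofReal (Real.exp (s * y ^ 2 / 2))) y
      = ENNReal.ofReal ((√(2 * Real.pi))⁻¹ * Real.exp (-((1 - s) / 2) * y ^ 2)) := fun y => by
    simp only [Pi.mul_apply, gaussianPDF, gaussianPDFReal]
    rw [← ENNReal.ofReal_mul (by positivity), mul_assoc, ← Real.exp_add]
    congr 3
    · simp
    · simp; ring
  simp_rw [hpt]
  rw [← ofReal_integral_eq_lintegral_ofReal ((integrable_exp_neg_mul_sq hb).const_mul _)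
    (ae_of_all _ fun y => by positivity), integral_const_mul, integral_gaussian]
  refine ENNReal.ofReal_le_ofReal ?_
  rw [← Real.sqrt_inv, ← Real.sqrt_mul (by positivity), Real.sqrt_le_left (Real.exp_pos _).le,
    show (2 * Real.pi)⁻¹ * (Real.pi / ((1 - s) / 2)) = (1 - s)⁻¹ by
      have := Real.pi_pos; have : (1 : ℝ) - s ≠ 0 := by linarith
      field_simp,
    inv_le_iff_one_le_mul₀ (by linarith), ← Real.exp_nat_mul]
  have := Real.add_one_le_exp ((2 : ℕ) * s)
  push_cast at this ⊢
  nlinarith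

/-- A product of two independent centred Gaussian variables is sub-exponential. -/
lemma lintegral_exp_mul_gaussianReal_prod_le {a b : ℝ} (hab : (a * b) ^ 2 ≤ 1 / 4) :
    ∫⁻ p : ℝ × ℝ, ENNReal.ofReal (Real.exp ((a * p.1) * (b * p.2)))
        ∂((gaussianReal 0 1).prod (gaussianReal 0 1))
      ≤ ENNReal.ofReal (Real.exp ((a * b) ^ 2)) := by
  rw [lintegral_prod_symm _ (by fun_prop)]
  refine le_trans (le_of_eq (lintegral_congr fun y => ?_))
    (lintegral_exp_mul_sq_gaussianReal_le (sq_nonneg (a * b)) hab)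
  have h := congrFun (mgf_fun_id_gaussianReal (μ := 0) (v := 1)) (a * b * y)
  have hi := integrable_exp_mul_gaussianReal (μ := 0) (v := 1) (a * b * y)
  rw [mgf] at h
  simp_rw [show ∀ x : ℝ, (a * x) * (b * y) = a * b * y * x from fun x => by ring]
  rw [← ofReal_integral_eq_lintegral_ofReal hi (ae_of_all _ fun x => (Real.exp_pos _).le), h]
  congr 2
  simp; ring

lemma dotProduct_self_nonneg_real {ι : Type*} [Fintype ι] (v : ι → ℝ) : 0 ≤ v ⬝ᵥ v :=
  Finset.sum_nonneg fun i _ => mul_self_nonneg (v i)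

lemma hasLaw_eval_gaussianVec {n : ℕ} (i : Fin n) :
    HasLaw (fun a : Fin n → ℝ => a i) (gaussianReal 0 1) (gaussianVec n) :=
  (measurePreserving_eval (fun _ : Fin n => gaussianReal 0 1) i).hasLaw

lemma hasGaussianLaw_eval_gaussianVec (n : ℕ) :
    HasGaussianLaw (fun (a : Fin n → ℝ) i => a i) (gaussianVec n) :=
  iIndepFun.hasGaussianLaw (fun i => (hasLaw_eval_gaussianVec i).hasGaussianLaw)
    (iIndepFun_pi (X := fun _ => id) fun _ => aemeasurable_id)

lemma hasGaussianLaw_dotProduct_gaussianVec {n : ℕ} (u w : Fin n → ℝ) :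
    HasGaussianLaw (fun a : Fin n → ℝ => (a ⬝ᵥ u, a ⬝ᵥ w)) (gaussianVec n) := by
  refine (hasGaussianLaw_eval_gaussianVec n).map_fun
    (LinearMap.toContinuousLinearMap
      { toFun := fun a : Fin n → ℝ => (a ⬝ᵥ u, a ⬝ᵥ w)
        map_add' := fun a b => by simp
        map_smul' := fun c a => by simp })

lemma covariance_dotProduct_gaussianVec {n : ℕ} (u w : Fin n → ℝ) :
    cov[fun a => a ⬝ᵥ u, fun a => a ⬝ᵥ w; gaussianVec n] = u ⬝ᵥ w := by
  have hL : ∀ i : Fin n, MemLp (fun a : Fin n → ℝ => a i) 2 (gaussianVec n) := fun i =>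
    (hasLaw_eval_gaussianVec i).hasGaussianLaw.memLp_two
  have hcov : ∀ i j : Fin n, cov[fun a : Fin n → ℝ => a i, fun a => a j; gaussianVec n]
      = if i = j then 1 else 0 := fun i j => by
    split_ifs with h
    · subst h
      rw [covariance_self (hL i).aestronglyMeasurable.aemeasurable,
        (hasLaw_eval_gaussianVec i).variance_eq]
      simp
    · exact ((iIndepFun_pi (μ := fun _ : Fin n => gaussianReal 0 1) (X := fun _ => id)
        fun _ => aemeasurable_id).indepFun h).covariance_eq_zero (hL i) (hL j)
  simp only [dotProduct]
  rw [covariance_fun_sum_fun_sum (fun i => (hL i).mul_const _) (fun i => (hL i).mul_const _)]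
  simp [covariance_mul_const_left, covariance_mul_const_right, hcov]

lemma integral_dotProduct_gaussianVec {n : ℕ} (u : Fin n → ℝ) :
    ∫ a, a ⬝ᵥ u ∂gaussianVec n = 0 := by
  simp only [dotProduct]
  rw [integral_finsetSum _ fun i _ =>
    (hasLaw_eval_gaussianVec i).hasGaussianLaw.integrable.mul_const _]
  simp [integral_mul_const, (hasLaw_eval_gaussianVec _).integral_eq]

lemma map_dotProduct_gaussianVec {n : ℕ} (u : Fin n → ℝ) :
    (gaussianVec n).map (fun a => a ⬝ᵥ u) = (gaussianReal 0 1).map (√(u ⬝ᵥ u) * ·) := by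
  have hG := (hasGaussianLaw_dotProduct_gaussianVec u u).fst
  rw [hG.map_eq_gaussianReal, gaussianReal_map_const_mul, integral_dotProduct_gaussianVec,
    ← covariance_self hG.aemeasurable, covariance_dotProduct_gaussianVec]
  have h : 0 ≤ u ⬝ᵥ u := dotProduct_self_nonneg_real u
  congr 1
  · simp
  · ext
    simp [h]

lemma lintegral_exp_dotProduct_mul_dotProduct_le {n : ℕ} {u w : Fin n → ℝ} (huw : u ⬝ᵥ w = 0)
    (h : (u ⬝ᵥ u) * (w ⬝ᵥ w) ≤ 1 / 4) :
    ∫⁻ a, ENNReal.ofReal (Real.exp ((a ⬝ᵥ u) * (a ⬝ᵥ w))) ∂gaussianVec n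
      ≤ ENNReal.ofReal (Real.exp ((u ⬝ᵥ u) * (w ⬝ᵥ w))) := by
  have hG := hasGaussianLaw_dotProduct_gaussianVec u w
  have hind := hG.indepFun_of_covariance_eq_zero
    ((covariance_dotProduct_gaussianVec u w).trans huw)
  have hmap := (indepFun_iff_map_prod_eq_prod_map_map hG.fst.aemeasurable
    hG.snd.aemeasurable).1 hind
  have hsq : (√(u ⬝ᵥ u) * √(w ⬝ᵥ w)) ^ 2 = (u ⬝ᵥ u) * (w ⬝ᵥ w) := by
    rw [mul_pow, Real.sq_sqrt (dotProduct_self_nonneg_real u),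
      Real.sq_sqrt (dotProduct_self_nonneg_real w)]
  rw [map_dotProduct_gaussianVec, map_dotProduct_gaussianVec,
    Measure.map_prod_map _ _ (by fun_prop) (by fun_prop)] at hmap
  have hf : Measurable fun p : ℝ × ℝ => ENNReal.ofReal (Real.exp (p.1 * p.2)) := by fun_prop
  calc _ = ∫⁻ p, ENNReal.ofReal (Real.exp (p.1 * p.2))
          ∂(gaussianVec n).map fun a => (a ⬝ᵥ u, a ⬝ᵥ w) :=
        (lintegral_map' hf.aemeasurable hG.aemeasurable).symm
    _ ≤ _ := by
      rw [hmap, lintegral_map hf (by fun_prop), ← hsq]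
      exact lintegral_exp_mul_gaussianReal_prod_le (hsq ▸ h)

lemma lintegral_exp_sum_gaussianMatrices_le {q m n : ℕ} {u w : Fin q → Fin n → ℝ}
    (huw : ∀ k, u k ⬝ᵥ w k = 0) (h : ∀ k, (u k ⬝ᵥ u k) * (w k ⬝ᵥ w k) ≤ 1 / 4) :
    ∫⁻ ω, ENNReal.ofReal (Real.exp (∑ k, ∑ i, (ω k i ⬝ᵥ u k) * (ω k i ⬝ᵥ w k)))
        ∂gaussianMatrices q m n
      ≤ ENNReal.ofReal (Real.exp (m * ∑ k, (u k ⬝ᵥ u k) * (w k ⬝ᵥ w k))) := by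
  have hm : ∀ k, Measurable fun a : Fin n → ℝ =>
      ENNReal.ofReal (Real.exp ((a ⬝ᵥ u k) * (a ⬝ᵥ w k))) := fun k => by
    simp only [dotProduct]; fun_prop
  have hexp : ∀ {ι : Type} [Fintype ι] (f : ι → ℝ),
      ENNReal.ofReal (Real.exp (∑ i, f i)) = ∏ i, ENNReal.ofReal (Real.exp (f i)) := fun f => by
    rw [Real.exp_sum, ENNReal.ofReal_prod_of_nonneg fun i _ => (Real.exp_pos _).le]
  simp_rw [hexp, gaussianMatrices]
  rw [lintegral_pi_prod_eq_prod_lintegral _ (f := fun k (x : Fin m → Fin n → ℝ) =>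
    ∏ i, ENNReal.ofReal (Real.exp ((x i ⬝ᵥ u k) * (x i ⬝ᵥ w k))))
    fun k => Finset.measurable_prod _ fun i _ => (hm k).comp (measurable_pi_apply i)]
  rw [Finset.mul_sum, hexp]
  refine Finset.prod_le_prod' fun k _ => ?_
  rw [lintegral_pi_prod_eq_prod_lintegral _ (f := fun _ => _) fun _ => hm k]
  refine (Finset.prod_le_prod' fun i _ =>
    lintegral_exp_dotProduct_mul_dotProduct_le (huw k) (h k)).trans (le_of_eq ?_)
  rw [← hexp]
  simp

open Module Metric in
/-- A norm tail bound follows from uniform tail bounds for linear functionals, by averaging over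
the unit ball. -/
lemma measure_le_norm_le {E Ω : Type*} [NormedAddCommGroup E] [InnerProductSpace ℝ E]
    [FiniteDimensional ℝ E] [MeasurableSpace E] [BorelSpace E] [MeasurableSpace Ω]
    {P : Measure Ω} [IsProbabilityMeasure P] {X : Ω → E} (hX : Measurable X) {t : ℝ} (ht : 0 < t)
    {p : ℝ≥0∞} (hp : ∀ θ : E, ‖θ‖ ≤ 1 → P {ω | t / 2 ≤ inner ℝ θ (X ω)} ≤ p) :
    P {ω | t ≤ ‖X ω‖} ≤ ENNReal.ofReal (4 ^ finrank ℝ E) * p := by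
  let V : Measure E := volume
  have hV0 : V (ball 0 1) ≠ 0 := (measure_ball_pos _ _ one_pos).ne'
  have hVtop : V (ball 0 1) ≠ ∞ := measure_ball_lt_top.ne
  have hS : MeasurableSet {z : E × Ω | t / 2 ≤ inner ℝ z.1 (X z.2)} :=
    measurableSet_le measurable_const (measurable_fst.inner (hX.comp measurable_snd))
  have hA : MeasurableSet {ω | t ≤ ‖X ω‖} := measurableSet_le measurable_const hX.norm
  have hlow : ∀ ω ∈ {ω | t ≤ ‖X ω‖}, ENNReal.ofReal ((1 / 4) ^ finrank ℝ E) * V (ball 0 1)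
      ≤ V.restrict (ball 0 1) {θ | t / 2 ≤ inner ℝ θ (X ω)} := by
    intro ω (hω : t ≤ ‖X ω‖)
    have hx : 0 < ‖X ω‖ := ht.trans_le hω
    rw [← Measure.addHaar_ball_of_pos V ((3 / 4 * ‖X ω‖⁻¹) • X ω) (by norm_num : (0 : ℝ) < 1 / 4)]
    rw [Measure.restrict_apply' measurableSet_ball]
    refine measure_mono fun θ hθ => ?_
    rw [mem_ball, dist_eq_norm] at hθ
    have hc : ‖(3 / 4 * ‖X ω‖⁻¹) • X ω‖ = 3 / 4 := by
      rw [norm_smul, Real.norm_of_nonneg (by positivity)]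
      field_simp
    refine ⟨?_, ?_⟩
    · have h1 := abs_real_inner_le_norm (θ - (3 / 4 * ‖X ω‖⁻¹) • X ω) (X ω)
      have h2 : inner ℝ ((3 / 4 * ‖X ω‖⁻¹) • X ω) (X ω) = 3 / 4 * ‖X ω‖ := by
        rw [real_inner_smul_left, real_inner_self_eq_norm_sq]
        field_simp
      rw [inner_sub_left, h2] at h1
      have h3 := (abs_le.1 h1).1
      show t / 2 ≤ inner ℝ θ (X ω)
      nlinarith
    · rw [mem_ball_zero_iff]
      have := norm_sub_norm_le θ ((3 / 4 * ‖X ω‖⁻¹) • X ω)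
      linarith
  have key : ENNReal.ofReal ((1 / 4) ^ finrank ℝ E) * V (ball 0 1) * P {ω | t ≤ ‖X ω‖}
      ≤ p * V (ball 0 1) := by
    calc _ = ∫⁻ _ in {ω | t ≤ ‖X ω‖}, ENNReal.ofReal ((1 / 4) ^ finrank ℝ E) * V (ball 0 1) ∂P := by
          rw [setLIntegral_const]
      _ ≤ ∫⁻ ω in {ω | t ≤ ‖X ω‖}, V.restrict (ball 0 1) {θ | t / 2 ≤ inner ℝ θ (X ω)} ∂P :=
          setLIntegral_mono' hA hlow
      _ ≤ ∫⁻ ω, V.restrict (ball 0 1) {θ | t / 2 ≤ inner ℝ θ (X ω)} ∂P :=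
          setLIntegral_le_lintegral _ _
      _ = (V.restrict (ball 0 1)).prod P {z : E × Ω | t / 2 ≤ inner ℝ z.1 (X z.2)} :=
          (Measure.prod_apply_symm hS).symm
      _ = ∫⁻ θ in ball 0 1, P {ω | t / 2 ≤ inner ℝ θ (X ω)} ∂V := Measure.prod_apply hS
      _ ≤ ∫⁻ _ in ball 0 1, p ∂V :=
          setLIntegral_mono' measurableSet_ball fun θ hθ => hp θ (mem_ball_zero_iff.1 hθ).le
      _ = p * V (ball 0 1) := setLIntegral_const _ _
  rw [mul_right_comm, ENNReal.mul_le_mul_iff_left hV0 hVtop] at key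
  calc P {ω | t ≤ ‖X ω‖} = ENNReal.ofReal (4 ^ finrank ℝ E) *
        (ENNReal.ofReal ((1 / 4) ^ finrank ℝ E) * P {ω | t ≤ ‖X ω‖}) := by
        rw [← mul_assoc, ← ENNReal.ofReal_mul (by positivity), ← mul_pow]
        norm_num
    _ ≤ _ := by gcongr

lemma measure_le_of_lintegral_exp_le {Ω : Type*} [MeasurableSpace Ω] {P : Measure Ω} {Y : Ω → ℝ}
    (hY : Measurable Y) {l s K : ℝ} (hl : 0 < l)
    (h : ∫⁻ ω, ENNReal.ofReal (Real.exp (l * Y ω)) ∂P ≤ ENNReal.ofReal (Real.exp K)) :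
    P {ω | s ≤ Y ω} ≤ ENNReal.ofReal (Real.exp (K - l * s)) := by
  have hM := mul_meas_ge_le_lintegral (μ := P)
    (f := fun ω => ENNReal.ofReal (Real.exp (l * Y ω))) (by fun_prop)
    (ENNReal.ofReal (Real.exp (l * s)))
  have hset : {ω | ENNReal.ofReal (Real.exp (l * s)) ≤ ENNReal.ofReal (Real.exp (l * Y ω))}
      = {ω | s ≤ Y ω} := by
    ext ω
    simp [ENNReal.ofReal_le_ofReal_iff (Real.exp_pos _).le, hl]
  rw [hset] at hM
  rw [Real.exp_sub, ENNReal.ofReal_div_of_pos (Real.exp_pos _),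
    ENNReal.le_div_iff_mul_le (by simp [Real.exp_pos]) (by simp), mul_comm]
  exact hM.trans h

lemma vnorm_nonneg {ι : Type*} [Fintype ι] (v : ι → ℝ) : 0 ≤ vnorm v := Real.sqrt_nonneg _

lemma vnorm_sq {ι : Type*} [Fintype ι] (v : ι → ℝ) : vnorm v ^ 2 = v ⬝ᵥ v := by
  rw [vnorm, Real.sq_sqrt (Finset.sum_nonneg fun i _ => sq_nonneg _)]
  simp [dotProduct, sq]

lemma vnorm_eq_norm {ι : Type*} [Fintype ι] (v : ι → ℝ) : vnorm v = ‖WithLp.toLp 2 v‖ := by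
  simp [vnorm, EuclideanSpace.norm_eq]

lemma vnorm_smul {ι : Type*} [Fintype ι] (c : ℝ) (v : ι → ℝ) : vnorm (c • v) = |c| * vnorm v := by
  rw [vnorm_eq_norm, vnorm_eq_norm, WithLp.toLp_smul, norm_smul, Real.norm_eq_abs]

lemma dotProduct_le_vnorm_mul_vnorm {ι : Type*} [Fintype ι] (v w : ι → ℝ) :
    v ⬝ᵥ w ≤ vnorm v * vnorm w :=
  Real.sum_mul_le_sqrt_mul_sqrt Finset.univ v w

lemma vnorm_mulVec_le_frob_mul {ι ι' : Type*} [Fintype ι] [Fintype ι'] (M : Matrix ι ι' ℝ)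
    (z : ι' → ℝ) : vnorm (M *ᵥ z) ≤ frob M * vnorm z := by
  rw [vnorm, frob, vnorm, ← Real.sqrt_mul (by positivity), Finset.sum_mul]
  exact Real.sqrt_le_sqrt (Finset.sum_le_sum fun i _ =>
    Finset.sum_mul_sq_le_sq_mul_sq Finset.univ (M i) z)

lemma vnorm_mulVec_le_spec_mul {ι ι' : Type*} [Fintype ι] [Fintype ι'] (M : Matrix ι ι' ℝ)
    (z : ι' → ℝ) : vnorm (M *ᵥ z) ≤ spec M * vnorm z := by
  rcases (vnorm_nonneg z).eq_or_lt with h | h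
  · simpa [← h] using vnorm_mulVec_le_frob_mul M z
  have hbdd : BddAbove {c | ∃ z, vnorm z = 1 ∧ c = vnorm (M.mulVec z)} := by
    refine ⟨frob M, ?_⟩
    rintro _ ⟨y, hy, rfl⟩
    simpa [hy] using vnorm_mulVec_le_frob_mul M y
  have hle : vnorm (M *ᵥ ((vnorm z)⁻¹ • z)) ≤ spec M :=
    le_csSup hbdd ⟨_, by rw [vnorm_smul, abs_of_pos (inv_pos.2 h), inv_mul_cancel₀ h.ne'], rfl⟩
  rwa [mulVec_smul, vnorm_smul, abs_of_pos (inv_pos.2 h), inv_mul_le_iff₀ h, mul_comm] at hle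

lemma vnorm_transpose_mulVec_le {ι ι' : Type*} [Fintype ι] [Fintype ι'] (M : Matrix ι ι' ℝ)
    (x : ι → ℝ) : vnorm (Mᵀ *ᵥ x) ≤ spec M * vnorm x := by
  rcases (vnorm_nonneg (Mᵀ *ᵥ x)).eq_or_lt with h | h
  · have h1 := vnorm_mulVec_le_spec_mul M (Mᵀ *ᵥ x)
    have h0 : Mᵀ *ᵥ x = 0 := by
      refine dotProduct_self_eq_zero.1 ?_
      rw [← vnorm_sq, ← h]; norm_num
    have hs : 0 ≤ spec M := Real.sSup_nonneg (by rintro _ ⟨z, -, rfl⟩; exact vnorm_nonneg _)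
    rw [← h]
    exact mul_nonneg hs (vnorm_nonneg x)
  have h1 : vnorm (Mᵀ *ᵥ x) ^ 2 ≤ vnorm x * (spec M * vnorm (Mᵀ *ᵥ x)) := by
    calc vnorm (Mᵀ *ᵥ x) ^ 2 = x ⬝ᵥ M *ᵥ (Mᵀ *ᵥ x) := by
          rw [vnorm_sq, dotProduct_mulVec, ← mulVec_transpose, transpose_transpose, dotProduct_comm]
      _ ≤ vnorm x * vnorm (M *ᵥ (Mᵀ *ᵥ x)) := dotProduct_le_vnorm_mul_vnorm _ _
      _ ≤ _ := mul_le_mul_of_nonneg_left (vnorm_mulVec_le_spec_mul _ _) (vnorm_nonneg x)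
  nlinarith

lemma frob_sq {ι ι' : Type*} [Fintype ι] [Fintype ι'] (M : Matrix ι ι' ℝ) :
    frob M ^ 2 = ∑ i, ∑ j, M i j ^ 2 :=
  Real.sq_sqrt (Finset.sum_nonneg fun _ _ => Finset.sum_nonneg fun _ _ => sq_nonneg _)

/-- `‖ΘB‖_F ≤ ‖B‖ ‖Θ‖_F`, with the left side written columnwise. -/
lemma sum_vnorm_mulVec_col_sq_le {ι ι' κ : Type*} [Fintype ι] [Fintype ι'] [Fintype κ]
    (Θ : Matrix κ ι ℝ) (b : ι' → ι → ℝ) :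
    ∑ k, vnorm (Θ *ᵥ b k) ^ 2 ≤ spec (Matrix.of fun i k => b k i) ^ 2 * frob Θ ^ 2 := by
  have hrow : ∀ j, ∑ k, (Θ *ᵥ b k) j ^ 2
      = vnorm ((Matrix.of fun i k => b k i)ᵀ *ᵥ Θ j) ^ 2 := fun j => by
    rw [vnorm, Real.sq_sqrt (Finset.sum_nonneg fun i _ => sq_nonneg _)]
    refine Finset.sum_congr rfl fun k _ => ?_
    simp [mulVec, dotProduct, mul_comm]
  calc ∑ k, vnorm (Θ *ᵥ b k) ^ 2 = ∑ k, ∑ j, (Θ *ᵥ b k) j ^ 2 :=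
        Finset.sum_congr rfl fun k _ =>
          Real.sq_sqrt (Finset.sum_nonneg fun i _ => sq_nonneg _)
    _ = ∑ j, vnorm ((Matrix.of fun i k => b k i)ᵀ *ᵥ Θ j) ^ 2 := by
        rw [Finset.sum_comm]
        exact Finset.sum_congr rfl fun j _ => hrow j
    _ ≤ ∑ j, spec (Matrix.of fun i k => b k i) ^ 2 * ∑ l, Θ j l ^ 2 := by
        refine Finset.sum_le_sum fun j _ => ?_
        have h := pow_le_pow_left₀ (vnorm_nonneg _)
          (vnorm_transpose_mulVec_le (Matrix.of fun i k => b k i) (Θ j)) 2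
        rwa [mul_pow, vnorm, vnorm,
          Real.sq_sqrt (Finset.sum_nonneg fun l _ => sq_nonneg (Θ j l)), ← vnorm] at h
    _ = _ := by rw [← Finset.mul_sum, frob_sq]

section Projection

variable {n r : ℕ} {V : Matrix (Fin n) (Fin r) ℝ}

lemma vnorm_mulVec_of_orthonormal (hV : Vᵀ * V = 1) (x : Fin r → ℝ) :
    vnorm (V *ᵥ x) = vnorm x := by
  refine (pow_left_inj₀ (vnorm_nonneg _) (vnorm_nonneg _) two_ne_zero).1 ?_
  rw [vnorm_sq, vnorm_sq, dotProduct_mulVec, ← mulVec_transpose, mulVec_mulVec, hV, one_mulVec]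

lemma transpose_one_sub_mul_transpose (V : Matrix (Fin n) (Fin r) ℝ) :
    (1 - V * Vᵀ)ᵀ = 1 - V * Vᵀ := by
  simp

lemma one_sub_mul_transpose_mulVec_dotProduct (hV : Vᵀ * V = 1) (x : Fin n → ℝ)
    (y : Fin r → ℝ) : ((1 - V * Vᵀ) *ᵥ x) ⬝ᵥ (V *ᵥ y) = 0 := by
  rw [dotProduct_comm, dotProduct_mulVec, ← mulVec_transpose, transpose_one_sub_mul_transpose,
    mulVec_mulVec, Matrix.sub_mul, Matrix.one_mul, Matrix.mul_assoc, hV, Matrix.mul_one, sub_self,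
    zero_mulVec, zero_dotProduct]

lemma vnorm_one_sub_mul_transpose_mulVec_le (hV : Vᵀ * V = 1) (x : Fin n → ℝ) :
    vnorm ((1 - V * Vᵀ) *ᵥ x) ≤ vnorm x := by
  have hx : x = (1 - V * Vᵀ) *ᵥ x + V *ᵥ (Vᵀ *ᵥ x) := by
    rw [sub_mulVec, one_mulVec, mulVec_mulVec, sub_add_cancel]
  have horth := one_sub_mul_transpose_mulVec_dotProduct hV x (Vᵀ *ᵥ x)
  refine (pow_le_pow_iff_left₀ (vnorm_nonneg _) (vnorm_nonneg _) two_ne_zero).1 ?_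
  have h : vnorm x ^ 2 = vnorm ((1 - V * Vᵀ) *ᵥ x) ^ 2 + vnorm (V *ᵥ (Vᵀ *ᵥ x)) ^ 2 := by
    conv_lhs => rw [hx]
    rw [vnorm_sq, vnorm_sq, vnorm_sq, add_dotProduct, dotProduct_add, dotProduct_add,
      dotProduct_comm (V *ᵥ _) ((1 - V * Vᵀ) *ᵥ x), horth]
    ring
  nlinarith [sq_nonneg (vnorm (V *ᵥ (Vᵀ *ᵥ x)))]

end Projection

/-- The Frobenius inner product is `tr(Θᵀ M)`. -/
lemma inner_toLp_eq_trace {n r : ℕ} (θ : EuclideanSpace ℝ (Fin n × Fin r))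
    (M : Matrix (Fin n) (Fin r) ℝ) :
    inner ℝ θ (WithLp.toLp 2 fun p : Fin n × Fin r => M p.1 p.2)
      = ((Matrix.of fun j l => θ (j, l))ᵀ * M).trace := by
  rw [Matrix.trace, PiLp.inner_apply, Fintype.sum_prod_type, Finset.sum_comm]
  simp [Matrix.mul_apply, mul_comm]

lemma norm_toLp_eq_frob {n r : ℕ} (M : Matrix (Fin n) (Fin r) ℝ) :
    ‖(WithLp.toLp 2 fun p : Fin n × Fin r => M p.1 p.2 : EuclideanSpace ℝ (Fin n × Fin r))‖
      = frob M := by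
  simp [EuclideanSpace.norm_eq, frob, Fintype.sum_prod_type]

lemma trace_mul_sum_smul_vecMulVec {n r q m : ℕ} (Θ : Matrix (Fin n) (Fin r) ℝ)
    (Q : Matrix (Fin n) (Fin n) ℝ) (w : Fin q → Fin n → ℝ) (b : Fin q → Fin r → ℝ)
    (ω : Fin q → Fin m → Fin n → ℝ) :
    (Θᵀ * (Q * ∑ k, ∑ i, (ω k i ⬝ᵥ w k) • vecMulVec (ω k i) (b k))).trace
      = ∑ k, ∑ i, (ω k i ⬝ᵥ Qᵀ *ᵥ (Θ *ᵥ b k)) * (ω k i ⬝ᵥ w k) := by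
  simp only [Matrix.mul_sum, Matrix.trace_sum, Matrix.mul_smul, Matrix.trace_smul,
    mul_vecMulVec, trace_vecMulVec, smul_eq_mul]
  refine Finset.sum_congr rfl fun k _ => Finset.sum_congr rfl fun i _ => ?_
  rw [mul_comm, dotProduct_comm, dotProduct_mulVec, ← mulVec_transpose, transpose_transpose,
    dotProduct_mulVec (ω k i), ← mulVec_transpose, transpose_transpose, dotProduct_comm]

section Tail

variable {n r q m : ℕ} {V : Matrix (Fin n) (Fin r) ℝ} {v b : Fin q → Fin r → ℝ} {D E S l : ℝ}

lemma measure_le_linear_functional_le (hV : Vᵀ * V = 1) (hv : ∀ k, vnorm (v k) ≤ D)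
    (hb : ∀ k, vnorm (b k) ≤ E) (hS : spec (Matrix.of fun (i : Fin r) (k : Fin q) => b k i) ≤ S)
    (hD : 0 ≤ D) (hE : 0 ≤ E) (hl : 0 < l) (hlDE : l * D * E ≤ 1 / 2)
    {Θ : Matrix (Fin n) (Fin r) ℝ} (hΘ : frob Θ ≤ 1) (s : ℝ) :
    gaussianMatrices q m n {ω | s ≤ ∑ k, ∑ i,
        (ω k i ⬝ᵥ (1 - V * Vᵀ) *ᵥ (Θ *ᵥ b k)) * (ω k i ⬝ᵥ V *ᵥ v k)}
      ≤ ENNReal.ofReal (Real.exp (m * (l * D * S) ^ 2 - l * s)) := by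
  have hΘ0 : 0 ≤ frob Θ := Real.sqrt_nonneg _
  have hB0 : 0 ≤ spec (Matrix.of fun (i : Fin r) (k : Fin q) => b k i) :=
    Real.sSup_nonneg (by rintro _ ⟨z, -, rfl⟩; exact vnorm_nonneg _)
  set u : Fin q → Fin n → ℝ := fun k => (1 - V * Vᵀ) *ᵥ (Θ *ᵥ b k) with hu
  have hu1 : ∀ k, vnorm (u k) ≤ vnorm (Θ *ᵥ b k) := fun k =>
    vnorm_one_sub_mul_transpose_mulVec_le hV _
  have hu2 : ∀ k, vnorm (u k) ≤ E := fun k =>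
    (hu1 k).trans <| (vnorm_mulVec_le_frob_mul Θ (b k)).trans <|
      (mul_le_of_le_one_left (vnorm_nonneg _) hΘ).trans (hb k)
  have hw : ∀ k, vnorm (V *ᵥ v k) ≤ D := fun k =>
    (vnorm_mulVec_of_orthonormal hV (v k)).trans_le (hv k)
  have hprod : ∀ k, ((l • u k) ⬝ᵥ (l • u k)) * ((V *ᵥ v k) ⬝ᵥ (V *ᵥ v k))
      = (l * vnorm (V *ᵥ v k) * vnorm (u k)) ^ 2 := fun k => by
    rw [← vnorm_sq, ← vnorm_sq, vnorm_smul, abs_of_pos hl]; ring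
  have hsum : ∑ k, vnorm (u k) ^ 2 ≤ S ^ 2 := by
    calc ∑ k, vnorm (u k) ^ 2 ≤ ∑ k, vnorm (Θ *ᵥ b k) ^ 2 :=
          Finset.sum_le_sum fun k _ => pow_le_pow_left₀ (vnorm_nonneg _) (hu1 k) 2
      _ ≤ spec (Matrix.of fun (i : Fin r) (k : Fin q) => b k i) ^ 2 * frob Θ ^ 2 :=
          sum_vnorm_mulVec_col_sq_le Θ b
      _ ≤ S ^ 2 * 1 :=
          mul_le_mul (pow_le_pow_left₀ hB0 hS 2) (pow_le_one₀ hΘ0 hΘ) (by positivity)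
            (by positivity)
      _ = S ^ 2 := mul_one _
  refine measure_le_of_lintegral_exp_le (by simp only [dotProduct]; fun_prop) hl ?_
  have hmain := lintegral_exp_sum_gaussianMatrices_le (m := m) (u := fun k => l • u k)
    (w := fun k => V *ᵥ v k)
    (fun k => by rw [smul_dotProduct, one_sub_mul_transpose_mulVec_dotProduct hV, smul_zero])
    fun k => by
      rw [hprod]
      calc _ ≤ (l * D * E) ^ 2 := by
            have := vnorm_nonneg (u k)
            have := vnorm_nonneg (V *ᵥ v k)
            have := hw k
            have := hu2 k
            gcongr
        _ ≤ (1 / 2) ^ 2 := pow_le_pow_left₀ (by positivity) hlDE 2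
        _ = 1 / 4 := by norm_num
  refine le_trans (le_of_eq (lintegral_congr fun ω => ?_)) (hmain.trans ?_)
  · simp only [hu, dotProduct_smul, smul_eq_mul, Finset.mul_sum, mul_assoc]
  · refine ENNReal.ofReal_le_ofReal (Real.exp_le_exp.2 ?_)
    refine mul_le_mul_of_nonneg_left ?_ (Nat.cast_nonneg m)
    calc _ ≤ ∑ k, (l * D) ^ 2 * vnorm (u k) ^ 2 := by
          refine Finset.sum_le_sum fun k _ => ?_
          rw [hprod, mul_pow]
          have := vnorm_nonneg (V *ᵥ v k)
          have := hw k
          gcongr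
      _ ≤ (l * D) ^ 2 * S ^ 2 := by
          rw [← Finset.mul_sum]
          exact mul_le_mul_of_nonneg_left hsum (sq_nonneg _)
      _ = (l * D * S) ^ 2 := (mul_pow _ _ _).symm

lemma measure_le_frob_le (hV : Vᵀ * V = 1) (hv : ∀ k, vnorm (v k) ≤ D)
    (hb : ∀ k, vnorm (b k) ≤ E) (hS : spec (Matrix.of fun (i : Fin r) (k : Fin q) => b k i) ≤ S)
    (hD : 0 ≤ D) (hE : 0 ≤ E) (hl : 0 < l) (hlDE : l * D * E ≤ 1 / 2) {t : ℝ} (ht : 0 < t) :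
    gaussianMatrices q m n {ω | t ≤ frob ((1 - V * Vᵀ) * ∑ k, ∑ i,
        (ω k i ⬝ᵥ V *ᵥ v k) • vecMulVec (ω k i) (b k))}
      ≤ ENNReal.ofReal (4 ^ (n * r) * Real.exp (m * (l * D * S) ^ 2 - l * (t / 2))) := by
  have hX : Measurable fun ω : Fin q → Fin m → Fin n → ℝ =>
      (WithLp.toLp 2 fun p : Fin n × Fin r => ((1 - V * Vᵀ) * ∑ k, ∑ i,
        (ω k i ⬝ᵥ V *ᵥ v k) • vecMulVec (ω k i) (b k) : Matrix (Fin n) (Fin r) ℝ) p.1 p.2 :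
        EuclideanSpace ℝ (Fin n × Fin r)) := by
    simp only [Matrix.mul_apply, Matrix.sum_apply, Matrix.smul_apply, vecMulVec_apply, dotProduct,
      smul_eq_mul]
    fun_prop
  have h := measure_le_norm_le (P := gaussianMatrices q m n) hX ht
    (p := ENNReal.ofReal (Real.exp (m * (l * D * S) ^ 2 - l * (t / 2)))) fun θ hθ => by
      simp only [inner_toLp_eq_trace, trace_mul_sum_smul_vecMulVec,
        transpose_one_sub_mul_transpose]
      refine measure_le_linear_functional_le hV hv hb hS hD hE hl hlDE ?_ _
      rw [← norm_toLp_eq_frob]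
      exact hθ
  simp only [norm_toLp_eq_frob] at h
  rw [ENNReal.ofReal_mul (by positivity)]
  simpa using h

end Tail

/-- **Lemma 3.5, part 2** (bound on Term2). -/
theorem lemma35_part2 :
    ∃ c C : ℝ, 0 < c ∧ 0 < C ∧
    ∀ (n r q m : ℕ), r ≤ q →
    ∀ (δ σp μ ε₂ : ℝ), 0 < δ → 0 < σp → 1 ≤ μ → 0 < ε₂ → ε₂ < 1 →
    ∀ (U Ustar : Matrix (Fin n) (Fin r) ℝ) (btil bhat : Fin q → Fin r → ℝ),
      Uᵀ * U = 1 → Ustarᵀ * Ustar = 1 →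
      (∀ k, vnorm (Ustarᵀ.mulVec (U.mulVec (bhat k)) - btil k) ≤
        2.5 * δ * μ * σp * Real.sqrt ((r : ℝ) / q)) →
      (∀ k, vnorm (bhat k) ≤ 1.1 * μ * σp * Real.sqrt ((r : ℝ) / q)) →
      spec (Matrix.of fun (i : Fin r) (k : Fin q) => bhat k i) ≤ 1.1 * σp →
      ENNReal.ofReal (1 - Real.exp (C * ((n : ℝ) * r) - c * m * q * ε₂ ^ 2 / (r * μ ^ 2))) ≤
        gaussianMatrices q m n {ω | frob ((1 - Ustar * Ustarᵀ) * ∑ k, ∑ i,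
            (ω k i ⬝ᵥ Ustar.mulVec (Ustarᵀ.mulVec (U.mulVec (bhat k)) - btil k)) •
              vecMulVec (ω k i) (bhat k)) ≤ 1.1 * ε₂ * δ * m * σp ^ 2} := by
  refine ⟨99 / 10000, 2, by norm_num, by norm_num, ?_⟩
  intro n r q m hrq δ σp μ ε hδ hσ hμ hε _ U V b' b _ hV hv hb hS
  have hμ0 : 0 < μ := by linarith
  rcases Nat.eq_zero_or_pos r with rfl | hr
  · refine le_trans (ENNReal.ofReal_le_one.2 (sub_le_self _ (Real.exp_pos _).le)) (le_of_eq ?_)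
    rw [← measure_univ (μ := gaussianMatrices q m n)]
    congr 1
    ext ω
    simp only [Set.mem_univ, Set.mem_ofPred_eq, true_iff]
    rw [frob]
    simp only [Finset.univ_eq_empty, Finset.sum_empty, Finset.sum_const_zero, Real.sqrt_zero]
    positivity
  rcases Nat.eq_zero_or_pos m with rfl | hm
  · refine le_trans (le_of_eq (ENNReal.ofReal_eq_zero.2 ?_)) zero_le
    rw [sub_nonpos]
    refine Real.one_le_exp ?_
    simp only [Nat.cast_zero, mul_zero, zero_mul, zero_div, sub_zero]
    positivity
  have hq : 0 < q := hr.trans_le hrq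
  have hr' : (0 : ℝ) < r := Nat.cast_pos.2 hr
  have hq' : (0 : ℝ) < q := Nat.cast_pos.2 hq
  have hm' : (0 : ℝ) < m := Nat.cast_pos.2 hm
  set x : ℝ := √((r : ℝ) / q) with hx
  have hx0 : 0 < x := Real.sqrt_pos.2 (by positivity)
  have hx2 : x ^ 2 = r / q := Real.sq_sqrt (by positivity)
  have hrx : (r : ℝ) = x ^ 2 * q := by rw [hx2]; field_simp
  have ht : 0 < 1.1 * ε * δ * m * σp ^ 2 := by positivity
  have htail := measure_le_frob_le (m := m) (l := ε / (25 * δ * μ ^ 2 * σp ^ 2 * x ^ 2)) hV hv hb hS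
    (by positivity) (by positivity) (by positivity)
    (by field_simp; linarith) ht
  have hexp : (m : ℝ) * (ε / (25 * δ * μ ^ 2 * σp ^ 2 * x ^ 2) * (2.5 * δ * μ * σp * x)
        * (1.1 * σp)) ^ 2
      - ε / (25 * δ * μ ^ 2 * σp ^ 2 * x ^ 2) * (1.1 * ε * δ * m * σp ^ 2 / 2)
      = -(99 / 10000 * m * q * ε ^ 2 / (r * μ ^ 2)) := by
    rw [hrx]
    field_simp
    norm_num
  rw [hexp] at htail
  have hfour : (4 : ℝ) ^ (n * r) ≤ Real.exp (2 * ((n : ℝ) * r)) := by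
    have h4 : (4 : ℝ) ≤ Real.exp 2 := by
      have h := Real.add_one_le_exp 1
      rw [show (2 : ℝ) = 1 + 1 by norm_num, Real.exp_add]
      nlinarith
    calc (4 : ℝ) ^ (n * r) ≤ Real.exp 2 ^ (n * r) := pow_le_pow_left₀ (by norm_num) h4 _
      _ = _ := by rw [← Real.exp_nat_mul]; push_cast; ring_nf
  have hbound : (4 : ℝ) ^ (n * r) * Real.exp (-(99 / 10000 * m * q * ε ^ 2 / (r * μ ^ 2)))
      ≤ Real.exp (2 * ((n : ℝ) * r) - 99 / 10000 * m * q * ε ^ 2 / (r * μ ^ 2)) := by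
    rw [sub_eq_add_neg, Real.exp_add]
    gcongr
  rw [ENNReal.ofReal_sub _ (Real.exp_pos _).le, ENNReal.ofReal_one, tsub_le_iff_right,
    ← measure_univ (μ := gaussianMatrices q m n)]
  refine le_trans (measure_mono fun ω _ => ?_) ((measure_union_le _ _).trans
    (add_le_add_right (htail.trans (ENNReal.ofReal_le_ofReal hbound)) _))
  simpa using le_total _ _
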